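/- Let A be a closable subgroup of a group Γ. Then: (1) clo(A) is a strongly closable subgroup of Γ, and localrank(clo(A)) ≤ localrank(A); (2) A ≤ clo(A); (3) for any closable subgroup B of Γ with B ≤ A we have clo(B) ⊆ clo(A); and (4) clo(clo(A)) = clo(A) (where clo(clo(A)) is defined since clo(A) is a closable subgroup of Γ by (1)). -/

import Mathlib

/-- The rank of a subgroup, as an extended natural number: the minimal cardinality of a
finite generating set, or `⊤` if the subgroup is not finitely generated. -/
noncomputable def subgroupRank {Γ : Type*} [Group Γ] (H : Subgroup Γ) : ℕ∞ :=
  ⨅ (S : Finset Γ) (_ : Subgroup.closure (S : Set Γ) = H), (S.card : ℕ∞)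

/-- `A` has local rank at most `r` if every finitely generated subgroup of `A` is contained
in a subgroup of `A` of rank at most `r`. -/
def LocalRankLE {Γ : Type*} [Group Γ] (A : Subgroup Γ) (r : ℕ) : Prop :=
  ∀ B : Subgroup Γ, B ≤ A → B.FG →
    ∃ C : Subgroup Γ, C ≤ A ∧ B ≤ C ∧ subgroupRank C ≤ (r : ℕ∞)

/-- The local rank of a subgroup: the least `r` such that `LocalRankLE A r`, or `⊤` if
there is no such `r`. -/
noncomputable def localRank {Γ : Type*} [Group Γ] (A : Subgroup Γ) : ℕ∞ :=
  ⨅ (r : ℕ) (_ : LocalRankLE A r), (r : ℕ∞)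

/-- A group is `k`-free if every subgroup of rank at most `k` is free. -/
def KFree (Γ : Type*) [Group Γ] (k : ℕ) : Prop :=
  ∀ H : Subgroup Γ, subgroupRank H ≤ (k : ℕ∞) → IsFreeGroup H

/-- The index of freedom of `Γ`: the supremum of all `k` such that `Γ` is `k`-free. -/
noncomputable def iof (Γ : Type*) [Group Γ] : ℕ∞ :=
  ⨆ (k : ℕ) (_ : KFree Γ k), (k : ℕ∞)

/-- A subgroup `A` of `Γ` is strongly closable if `localRank A < iof Γ`. -/
def StronglyClosable {Γ : Type*} [Group Γ] (A : Subgroup Γ) : Prop :=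
  localRank A < iof Γ

/-- A subgroup `A` of `Γ` is closable if it has finite local rank and there is some `z ∈ Γ`
with `localRank ⟨A, z⟩ < iof Γ`. -/
def Closable {Γ : Type*} [Group Γ] (A : Subgroup Γ) : Prop :=
  localRank A < ⊤ ∧ ∃ z : Γ, localRank (A ⊔ Subgroup.closure {z}) < iof Γ

/-- An element `x` of `Γ` is `A`-admissible if `⟨A, x⟩` is strongly closable and
`localRank ⟨A, x⟩ ≤ localRank A`. -/
def Admissible {Γ : Type*} [Group Γ] (A : Subgroup Γ) (x : Γ) : Prop :=
  StronglyClosable (A ⊔ Subgroup.closure {x}) ∧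
    localRank (A ⊔ Subgroup.closure {x}) ≤ localRank A

/-- A sequence `x₁, …, x_m` is `A`-admissible if each `x_i` is `⟨A, x₁, …, x_{i-1}⟩`-admissible. -/
def AdmissibleSeq {Γ : Type*} [Group Γ] : Subgroup Γ → List Γ → Prop
  | _, [] => True
  | A, x :: xs => Admissible A x ∧ AdmissibleSeq (A ⊔ Subgroup.closure {x}) xs

/-- `clo A` is the set of all `x ∈ Γ` which occur as the last term of an `A`-admissible
sequence. -/
def clo {Γ : Type*} [Group Γ] (A : Subgroup Γ) : Set Γ :=
  { x | ∃ l : List Γ, AdmissibleSeq A (l ++ [x]) }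

/-- The homomorphism `ι_{A,x}` from the free product `A ∗ ⟨t⟩` to `Γ` restricting to the
inclusion on `A` and sending `t` to `x`. -/
noncomputable def iotaAX {Γ : Type*} [Group Γ] (A : Subgroup Γ) (x : Γ) :
    Monoid.Coprod (↥A) (Multiplicative ℤ) →* Γ :=
  Monoid.Coprod.lift A.subtype (zpowersHom Γ x)

/-- Elements `g 0, …, g (m-1)` of `Γ` are independent if they freely generate a free subgroup,
i.e. the induced homomorphism from the free group on `m` generators is injective. -/
def Independent {Γ : Type*} [Group Γ] {m : ℕ} (g : Fin m → Γ) : Prop :=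
  Function.Injective (FreeGroup.lift g : FreeGroup (Fin m) →* Γ)

open Classical in
theorem fg_resfin.{u} {α : Type u} (w : FreeGroup α) (hw : w ≠ 1) :
    ∃ (S : Type u) (_ : Finite S) (ρ : FreeGroup α →* Equiv.Perm S), ρ w ≠ 1 := by
  set L := w.toWord with hL
  let T : Set (FreeGroup α) := {g | ∃ l, l <:+ L ∧ FreeGroup.mk l = g}
  have hT : T.Finite := by
    have : T = (fun l => FreeGroup.mk l) '' {l | l ∈ L.tails} := by
      ext g; simp [T, List.mem_tails]
    rw [this]
    exact (List.finite_toSet _).image _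
  have : Finite T := hT
  have : Fintype T := Fintype.ofFinite T
  let e : ∀ a : α, {g : T // FreeGroup.of a * g.1 ∈ T} ≃ {g : T // (FreeGroup.of a)⁻¹ * g.1 ∈ T} :=
    fun a =>
    { toFun := fun g => ⟨⟨FreeGroup.of a * g.1.1, g.2⟩, by simp⟩
      invFun := fun g => ⟨⟨(FreeGroup.of a)⁻¹ * g.1.1, g.2⟩, by simp⟩
      left_inv := fun g => by simp
      right_inv := fun g => by simp }
  let σ : α → Equiv.Perm T := fun a => (e a).extendSubtype
  have hσ : ∀ a (g : T) (h : FreeGroup.of a * g.1 ∈ T), σ a g = ⟨FreeGroup.of a * g.1, h⟩ := by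
    intro a g h
    exact Equiv.extendSubtype_apply_of_mem (e a) g h
  have h1 : (1 : FreeGroup α) ∈ T := ⟨[], List.nil_suffix, rfl⟩
  refine ⟨T, inferInstance, FreeGroup.lift σ, ?_⟩
  have key : ∀ l (h : l <:+ L), FreeGroup.lift σ (FreeGroup.mk l) ⟨1, h1⟩ = ⟨FreeGroup.mk l, l, h, rfl⟩ := by
    intro l
    induction l with
    | nil => intro h; rfl
    | cons p l ih =>
      intro h
      have h' : l <:+ L := (List.suffix_cons p l).trans h
      obtain ⟨a, b⟩ := p
      have ih' := ih h'
      cases b with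
      | true =>
        have e1 : FreeGroup.mk ((a, true) :: l) = FreeGroup.of a * FreeGroup.mk l := rfl
        have e3 : FreeGroup.of a * FreeGroup.mk l ∈ T := ⟨(a, true) :: l, h, rfl⟩
        have e4 := hσ a ⟨FreeGroup.mk l, l, h', rfl⟩ e3
        have e5 : FreeGroup.lift σ (FreeGroup.mk ((a, true) :: l))
            = σ a * FreeGroup.lift σ (FreeGroup.mk l) := by
          rw [e1, map_mul, FreeGroup.lift_apply_of]
        rw [e5, Equiv.Perm.mul_apply, ih']
        exact e4
      | false =>
        have e1 : FreeGroup.mk ((a, false) :: l) = (FreeGroup.of a)⁻¹ * FreeGroup.mk l := rfl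
        have e2 : FreeGroup.of a * FreeGroup.mk ((a, false) :: l) = FreeGroup.mk l := by
          rw [e1]; simp
        have e3 : FreeGroup.of a * FreeGroup.mk ((a, false) :: l) ∈ T := by
          rw [e2]; exact ⟨l, h', rfl⟩
        have e4 := hσ a ⟨FreeGroup.mk ((a, false) :: l), (a, false) :: l, h, rfl⟩ e3
        have e5 : FreeGroup.lift σ (FreeGroup.mk ((a, false) :: l))
            = (σ a)⁻¹ * FreeGroup.lift σ (FreeGroup.mk l) := by
          rw [e1, map_mul, map_inv, FreeGroup.lift_apply_of]
        rw [e5, Equiv.Perm.mul_apply, ih', Equiv.Perm.inv_eq_iff_eq]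
        refine Eq.trans ?_ e4.symm
        exact Subtype.ext e2.symm
  intro hc
  have h2 := congrArg Subtype.val (key L List.suffix_rfl)
  have h3 : FreeGroup.mk L = w := FreeGroup.mk_toWord
  simp only [h3, hc] at h2
  exact hw h2.symm

theorem fg_hopf {α : Type*} [Finite α] (φ : FreeGroup α →* FreeGroup α)
    (hφ : Function.Surjective φ) : Function.Injective φ := by
  rw [injective_iff_map_eq_one]
  intro w hw
  by_contra hne
  obtain ⟨S, hS, ρ, hρ⟩ := fg_resfin w hne
  have : Finite (FreeGroup α →* Equiv.Perm S) :=
    Finite.of_equiv (α → Equiv.Perm S) FreeGroup.lift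
  have hinj : Function.Injective (fun τ : FreeGroup α →* Equiv.Perm S => τ.comp φ) := by
    intro τ τ' h
    exact (MonoidHom.cancel_right hφ).1 h
  obtain ⟨τ, hτ⟩ := Finite.surjective_of_injective hinj ρ
  apply hρ
  rw [← hτ]
  simp [hw]

theorem fg_card {X Y : Type*} [Finite X] (f : FreeGroup X →* FreeGroup Y)
    (hf : Function.Surjective f) : Finite Y ∧ Nat.card Y ≤ Nat.card X := by
  classical
  let F : (Y → Multiplicative (ZMod 2)) → (X → Multiplicative (ZMod 2)) :=
    fun u => FreeGroup.lift.symm ((FreeGroup.lift u).comp f)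
  have hF : Function.Injective F := by
    intro u v h
    have := FreeGroup.lift.symm.injective h
    exact FreeGroup.lift.injective ((MonoidHom.cancel_right hf).1 this)
  have : Finite (Multiplicative (ZMod 2)) := inferInstanceAs (Finite (ZMod 2))
  have : Finite (Y → Multiplicative (ZMod 2)) := Finite.of_injective F hF
  have : Nontrivial (Multiplicative (ZMod 2)) := inferInstanceAs (Nontrivial (ZMod 2))
  have hY : Finite Y := by
    apply Finite.of_injective (fun y : Y => (Pi.mulSingle (M := fun _ => Multiplicative (ZMod 2)) y (Multiplicative.ofAdd 1)))
    intro y z h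
    by_contra hne
    have := congrFun h y
    simp [Pi.mulSingle_eq_of_ne hne] at this
  refine ⟨hY, ?_⟩
  have := Nat.card_le_card_of_injective F hF
  have h2 : Nat.card (Multiplicative (ZMod 2)) = 2 := by
    rw [show Nat.card (Multiplicative (ZMod 2)) = Nat.card (ZMod 2) from rfl]; simp
  rw [Nat.card_fun, Nat.card_fun, h2] at this
  exact (Nat.pow_le_pow_iff_right (by norm_num)).1 this

theorem fg_drop {Γ : Type*} [Group Γ] {X : Type*} [Finite X] (f : FreeGroup X →* Γ)
    (D : Subgroup Γ) (hD : f.range = D) [IsFreeGroup D] (hf : ¬ Function.Injective f) :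
    ∃ S : Finset Γ, S.card < Nat.card X ∧ Subgroup.closure (S : Set Γ) = D := by
  classical
  subst hD
  let e := IsFreeGroup.toFreeGroup f.range
  let g : FreeGroup X →* FreeGroup (IsFreeGroup.Generators f.range) :=
    e.toMonoidHom.comp f.rangeRestrict
  have hg : Function.Surjective g := e.surjective.comp f.rangeRestrict_surjective
  obtain ⟨hY, hc⟩ := fg_card g hg
  have hlt : Nat.card (IsFreeGroup.Generators f.range) < Nat.card X := by
    refine lt_of_le_of_ne hc fun heq => hf ?_
    let ε : IsFreeGroup.Generators f.range ≃ X := (Finite.card_eq.1 heq).some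
    let ε' := FreeGroup.freeGroupCongr ε
    have := fg_hopf (ε'.toMonoidHom.comp g) (ε'.surjective.comp hg)
    intro a b hab
    apply this
    have : f.rangeRestrict a = f.rangeRestrict b := Subtype.ext hab
    simp [g, this]
  have := Fintype.ofFinite (IsFreeGroup.Generators f.range)
  refine ⟨Finset.univ.image fun y => ((e.symm (FreeGroup.of y) : f.range) : Γ), ?_, ?_⟩
  · refine lt_of_le_of_lt Finset.card_image_le ?_
    rwa [Finset.card_univ, ← Nat.card_eq_fintype_card]
  · have h1 : ((Finset.univ.image fun y => ((e.symm (FreeGroup.of y) : f.range) : Γ) : Finset Γ) : Set Γ)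
      = (f.range.subtype.comp e.symm.toMonoidHom) '' (Set.range FreeGroup.of) := by
      ext z; simp
    rw [h1, ← MonoidHom.map_closure, FreeGroup.closure_range_of, ← MonoidHom.range_eq_map,
      MonoidHom.range_comp]
    have h2 : e.symm.toMonoidHom.range = ⊤ := MonoidHom.range_eq_top.2 e.symm.surjective
    rw [h2, ← MonoidHom.range_eq_map]
    simp

theorem sr_le {Γ : Type*} [Group Γ] (H : Subgroup Γ) (n : ℕ) :
    subgroupRank H ≤ (n : ℕ∞) ↔ ∃ S : Finset Γ, S.card ≤ n ∧ Subgroup.closure (S : Set Γ) = H := by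
  constructor
  · intro h
    have h2 : subgroupRank H < ((n + 1 : ℕ) : ℕ∞) :=
      lt_of_le_of_lt h (by exact_mod_cast Nat.lt_succ_self n)
    unfold subgroupRank at h2
    simp only [iInf_lt_iff] at h2
    obtain ⟨S, hS, hc⟩ := h2
    exact ⟨S, by have : S.card < n + 1 := by exact_mod_cast hc
                 omega, hS⟩
  · rintro ⟨S, hc, hS⟩
    exact (iInf₂_le S hS).trans (by exact_mod_cast hc)

theorem LocalRankLE.mono' {Γ : Type*} [Group Γ] {A : Subgroup Γ} {m n : ℕ} (h : LocalRankLE A m)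
    (hmn : m ≤ n) : LocalRankLE A n := by
  intro B h1 h2
  obtain ⟨C, a, b, c⟩ := h B h1 h2
  exact ⟨C, a, b, c.trans (by exact_mod_cast hmn)⟩

theorem lr_le {Γ : Type*} [Group Γ] (A : Subgroup Γ) (n : ℕ) :
    localRank A ≤ (n : ℕ∞) ↔ LocalRankLE A n := by
  constructor
  · intro h
    have h2 : localRank A < ((n + 1 : ℕ) : ℕ∞) :=
      lt_of_le_of_lt h (by exact_mod_cast Nat.lt_succ_self n)
    unfold localRank at h2
    simp only [iInf_lt_iff] at h2
    obtain ⟨r, hr, hc⟩ := h2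
    have : r < n + 1 := by exact_mod_cast hc
    exact hr.mono' (by omega)
  · intro h
    exact iInf₂_le n h

theorem kfree_of_lt {Γ : Type*} [Group Γ] {s : ℕ} (h : (s : ℕ∞) < iof Γ) : KFree Γ (s + 1) := by
  unfold iof at h
  simp only [lt_iSup_iff] at h
  obtain ⟨k, hk, hs⟩ := h
  have : s < k := by exact_mod_cast hs
  intro H hH
  exact hk H (hH.trans (by exact_mod_cast this))

def RR {Γ : Type*} [Group Γ] (A : Subgroup Γ) (x : Γ) : Subgroup (Γ × Γ) :=
  Subgroup.closure ({p | p.1 = p.2 ∧ p.1 ∈ A} ∪ {(x, 1)})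

def PP {Γ : Type*} [Group Γ] (A : Subgroup Γ) (x : Γ) : Prop :=
  x = 1 ∨ ∃ b, b ≠ 1 ∧ ((1 : Γ), b) ∈ RR A x

theorem RR_mono {Γ : Type*} [Group Γ] {A B : Subgroup Γ} (h : A ≤ B) (x : Γ) : RR A x ≤ RR B x := by
  apply Subgroup.closure_mono
  apply Set.union_subset_union_left
  rintro p ⟨h1, h2⟩
  exact ⟨h1, h h2⟩

theorem PP_mono {Γ : Type*} [Group Γ] {A B : Subgroup Γ} (h : A ≤ B) {x : Γ} (hp : PP A x) : PP B x := by
  rcases hp with hp | ⟨b, hb, hm⟩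
  · exact Or.inl hp
  · exact Or.inr ⟨b, hb, RR_mono h x hm⟩

theorem RR_fin {Γ : Type*} [Group Γ] {A : Subgroup Γ} {x : Γ} {p : Γ × Γ} (hp : p ∈ RR A x) :
    ∃ F : Subgroup Γ, F.FG ∧ F ≤ A ∧ p ∈ RR F x := by
  induction hp using Subgroup.closure_induction with
  | mem p hp =>
    rcases hp with ⟨h1, h2⟩ | h
    · refine ⟨Subgroup.closure {p.1}, ⟨{p.1}, by simp⟩, by simpa using h2, ?_⟩
      exact Subgroup.subset_closure (Or.inl ⟨h1, Subgroup.subset_closure rfl⟩)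
    · exact ⟨⊥, Subgroup.FG.bot, bot_le, Subgroup.subset_closure (Or.inr h)⟩
  | one => exact ⟨⊥, Subgroup.FG.bot, bot_le, one_mem _⟩
  | mul p q _ _ h1 h2 =>
    obtain ⟨F, a, b, c⟩ := h1
    obtain ⟨G, a', b', c'⟩ := h2
    exact ⟨F ⊔ G, a.sup a', sup_le b b', mul_mem (RR_mono le_sup_left x c) (RR_mono le_sup_right x c')⟩
  | inv p _ h1 =>
    obtain ⟨F, a, b, c⟩ := h1
    exact ⟨F, a, b, inv_mem c⟩

theorem PP_fin {Γ : Type*} [Group Γ] {A : Subgroup Γ} {x : Γ} (hp : PP A x) :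
    ∃ F : Subgroup Γ, F.FG ∧ F ≤ A ∧ PP F x := by
  rcases hp with hp | ⟨b, hb, hm⟩
  · exact ⟨⊥, Subgroup.FG.bot, bot_le, Or.inl hp⟩
  · obtain ⟨F, h1, h2, h3⟩ := RR_fin hm
    exact ⟨F, h1, h2, Or.inr ⟨b, hb, h3⟩⟩

theorem fg_dir {Γ : Type*} [Group Γ] {Q : Subgroup Γ → Prop} (h0 : ∃ K, Q K)
    (hdir : ∀ K L, Q K → Q L → ∃ M, Q M ∧ K ≤ M ∧ L ≤ M) {E : Subgroup Γ} (hE : E.FG)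
    (hmem : ∀ g ∈ E, ∃ K, Q K ∧ g ∈ K) : ∃ K, Q K ∧ E ≤ K := by
  classical
  obtain ⟨S, rfl⟩ := hE
  have : ∀ T : Finset Γ, T ⊆ S → ∃ K, Q K ∧ (T : Set Γ) ⊆ K := by
    intro T
    induction T using Finset.induction_on with
    | empty => intro _; obtain ⟨K, hK⟩ := h0; exact ⟨K, hK, by simp⟩
    | insert a T ha ih =>
      intro h
      obtain ⟨K, hK, hTK⟩ := ih ((Finset.subset_insert a T).trans h)
      obtain ⟨L, hL, haL⟩ := hmem a (Subgroup.subset_closure (h (Finset.mem_insert_self a T)))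
      obtain ⟨M, hM, h1, h2⟩ := hdir K L hK hL
      refine ⟨M, hM, ?_⟩
      rw [Finset.coe_insert, Set.insert_subset_iff]
      exact ⟨h2 haL, hTK.trans h1⟩
  obtain ⟨K, hK, h⟩ := this S (Finset.Subset.refl S)
  exact ⟨K, hK, (Subgroup.closure_le K).2 h⟩

theorem sup_fin {Γ : Type*} [Group Γ] {A : Subgroup Γ} {x g : Γ} (hg : g ∈ A ⊔ Subgroup.closure {x}) :
    ∃ F : Subgroup Γ, F.FG ∧ F ≤ A ∧ g ∈ F ⊔ Subgroup.closure {x} := by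
  rw [Subgroup.sup_eq_closure] at hg
  induction hg using Subgroup.closure_induction with
  | mem p hp =>
    rcases hp with h2 | h
    · refine ⟨Subgroup.closure {p}, ⟨{p}, by simp⟩, by simpa using h2, ?_⟩
      exact Subgroup.mem_sup_left (Subgroup.subset_closure rfl)
    · exact ⟨⊥, Subgroup.FG.bot, bot_le, Subgroup.mem_sup_right h⟩
  | one => exact ⟨⊥, Subgroup.FG.bot, bot_le, one_mem _⟩
  | mul p q _ _ h1 h2 =>
    obtain ⟨F, a, b, c⟩ := h1
    obtain ⟨G, a', b', c'⟩ := h2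
    exact ⟨F ⊔ G, a.sup a', sup_le b b', mul_mem
      ((sup_le_sup_right le_sup_left _ : F ⊔ Subgroup.closure {x} ≤ F ⊔ G ⊔ Subgroup.closure {x}) c)
      ((sup_le_sup_right le_sup_right _ : G ⊔ Subgroup.closure {x} ≤ F ⊔ G ⊔ Subgroup.closure {x}) c')⟩
  | inv p _ h1 =>
    obtain ⟨F, a, b, c⟩ := h1
    exact ⟨F, a, b, inv_mem c⟩

theorem L2 {Γ : Type*} [Group Γ] {B : Subgroup Γ} (hB : StronglyClosable B) {x : Γ} (hp : PP B x) :
    Admissible B x := by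
  classical
  have hfin : localRank B ≠ ⊤ := ne_top_of_lt hB
  obtain ⟨r, hr⟩ := ENat.ne_top_iff_exists.1 hfin
  suffices h : LocalRankLE (B ⊔ Subgroup.closure {x}) r by
    have h' := (lr_le _ _).2 h
    rw [hr] at h'
    exact ⟨lt_of_le_of_lt h' hB, h'⟩
  have hBr : LocalRankLE B r := (lr_le _ _).1 hr.ge
  have hlt : (r : ℕ∞) < iof Γ := by rw [hr]; exact hB
  intro E hE hEfg
  obtain ⟨F0, f1, f2, f3⟩ := PP_fin hp
  obtain ⟨K, ⟨F, g1, g2, rfl⟩, hEK⟩ := fg_dir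
    (Q := fun K => ∃ F : Subgroup Γ, F.FG ∧ F ≤ B ∧ K = F ⊔ Subgroup.closure {x})
    ⟨_, ⊥, Subgroup.FG.bot, bot_le, rfl⟩ (by
      rintro _ _ ⟨F, a, b, rfl⟩ ⟨G, a', b', rfl⟩
      exact ⟨_, ⟨F ⊔ G, a.sup a', sup_le b b', rfl⟩, sup_le_sup_right le_sup_left _,
        sup_le_sup_right le_sup_right _⟩) hEfg (by
      intro g hg
      obtain ⟨F, a, b, c⟩ := sup_fin (hE hg)
      exact ⟨_, ⟨F, a, b, rfl⟩, c⟩)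
  obtain ⟨C, c1, c2, c3⟩ := hBr (F0 ⊔ F) (sup_le f2 g2) (f1.sup g1)
  refine ⟨C ⊔ Subgroup.closure {x}, sup_le_sup_right c1 _,
    hEK.trans (sup_le_sup_right (le_sup_right.trans c2) _), ?_⟩
  have hpC : PP C x := PP_mono (le_sup_left.trans c2) f3
  obtain ⟨T, hT, rfl⟩ := (sr_le _ _).1 c3
  let f : FreeGroup (Option T) →* Γ := FreeGroup.lift (fun o => o.elim x (fun t => t.1))
  let f' : FreeGroup (Option T) →* Γ := FreeGroup.lift (fun o => o.elim 1 (fun t => t.1))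
  have hrange : f.range = Subgroup.closure (T : Set Γ) ⊔ Subgroup.closure {x} := by
    rw [FreeGroup.range_lift_eq_closure, ← Subgroup.closure_union]
    congr 1
    ext z
    simp only [Set.mem_range, Option.exists, Option.elim, Set.mem_union, Set.mem_singleton_iff]
    constructor
    · rintro (h | ⟨t, rfl⟩)
      · exact Or.inr h.symm
      · exact Or.inl t.2
    · rintro (h | h)
      · exact Or.inr ⟨⟨z, h⟩, rfl⟩
      · exact Or.inl h.symm
  have hfree : IsFreeGroup ↥(Subgroup.closure (T : Set Γ) ⊔ Subgroup.closure {x}) := by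
    apply kfree_of_lt hlt
    rw [sr_le]
    refine ⟨insert x T, (Finset.card_insert_le _ _).trans (by omega), ?_⟩
    rw [← Subgroup.closure_union, Finset.coe_insert, Set.union_singleton]
  have hninj : ¬ Function.Injective f := by
    intro hinj
    have h1 : ∀ g ∈ Subgroup.closure (T : Set Γ), (g, g) ∈ (f.prod f').range := by
      intro g hg
      induction hg using Subgroup.closure_induction with
      | mem g hg => exact ⟨FreeGroup.of (some ⟨g, hg⟩), by simp [f, f']⟩
      | one => exact one_mem _
      | mul p q _ _ h1 h2 => exact mul_mem h1 h2
      | inv p _ h1 => exact inv_mem h1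
    have h2 : RR (Subgroup.closure (T : Set Γ)) x ≤ (f.prod f').range := by
      unfold RR
      rw [Subgroup.closure_le]
      rintro ⟨p, q⟩ (⟨h, h'⟩ | h)
      · simp only at h h'
        subst h
        exact h1 p h'
      · simp only [Set.mem_singleton_iff, Prod.mk.injEq] at h
        obtain ⟨rfl, rfl⟩ := h
        exact ⟨FreeGroup.of none, by simp [f, f']⟩
    rcases hpC with h | ⟨b, hb, hm⟩
    · have : f (FreeGroup.of none) = f 1 := by simp [f, h]
      exact FreeGroup.of_ne_one _ (hinj this)
    · obtain ⟨w, hw⟩ := h2 hm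
      simp only [MonoidHom.prod_apply, Prod.mk.injEq] at hw
      have : w = 1 := hinj (by rw [hw.1, map_one])
      apply hb
      rw [← hw.2, this, map_one]
  obtain ⟨S, hS, hS'⟩ := fg_drop f _ hrange hninj
  rw [sr_le]
  refine ⟨S, ?_, hS'⟩
  have : Nat.card (Option T) = T.card + 1 := by simp
  omega

theorem L1 {Γ : Type*} [Group Γ] {A : Subgroup Γ} {x : Γ} (h : Admissible A x) : PP A x := by
  classical
  by_contra hn
  unfold PP at hn
  push Not at hn
  obtain ⟨hx, hR⟩ := hn
  obtain ⟨hsc, hle⟩ := h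
  obtain ⟨s, hs⟩ := ENat.ne_top_iff_exists.1 (ne_top_of_lt hsc)
  have hlr : LocalRankLE (A ⊔ Subgroup.closure {x}) s := (lr_le _ _).1 hs.ge
  have hlt : (s : ℕ∞) < iof Γ := by rw [hs]; exact hsc
  have hR' : ∀ b, ((1 : Γ), b) ∈ RR A x → b = 1 := fun b hb => by
    by_contra hne; exact hR b hne hb
  have huniq : ∀ a b b', (a, b) ∈ RR A x → (a, b') ∈ RR A x → b = b' := by
    intro a b b' h1 h2
    have := hR' (b * b'⁻¹) (by simpa using mul_mem h1 (inv_mem h2))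
    exact mul_inv_eq_one.1 this
  have hAA : ∀ a ∈ A, (a, a) ∈ RR A x := fun a ha => Subgroup.subset_closure (Or.inl ⟨rfl, ha⟩)
  have hx1 : (x, 1) ∈ RR A x := Subgroup.subset_closure (Or.inr rfl)
  have hsnd : ∀ p ∈ RR A x, p.2 ∈ A := by
    have : RR A x ≤ A.comap (MonoidHom.snd Γ Γ) := by
      unfold RR
      rw [Subgroup.closure_le]
      rintro ⟨p, q⟩ (⟨h, h'⟩ | h)
      · simp only at h h'
        subst h
        exact h'
      · simp only [Set.mem_singleton_iff, Prod.mk.injEq] at h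
        obtain ⟨rfl, rfl⟩ := h
        exact A.one_mem
    exact fun p hp => this hp
  let φ : RR A x →* Γ := (MonoidHom.fst Γ Γ).comp (RR A x).subtype
  have hφ : Function.Injective φ := by
    rintro ⟨⟨a, b⟩, h1⟩ ⟨⟨a', b'⟩, h2⟩ h
    have : a = a' := h
    subst this
    have := huniq a b b' h1 h2
    subst this
    rfl
  have hφr : A ⊔ Subgroup.closure {x} ≤ φ.range := by
    refine sup_le (fun a ha => ⟨⟨_, hAA a ha⟩, rfl⟩) ?_
    rw [Subgroup.closure_le, Set.singleton_subset_iff]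
    exact ⟨⟨_, hx1⟩, rfl⟩
  have key : ∀ B : Subgroup Γ, B ≤ A → B.FG → ∃ D : Subgroup Γ, D ≤ A ∧ B ≤ D ∧
      ∃ S : Finset Γ, S.card < s ∧ Subgroup.closure (S : Set Γ) = D := by
    intro B hBA hBfg
    obtain ⟨C, c1, c2, c3⟩ := hlr (B ⊔ Subgroup.closure {x}) (sup_le_sup_right hBA _)
      (hBfg.sup ⟨{x}, by simp⟩)
    obtain ⟨T, hT, rfl⟩ := (sr_le _ _).1 c3
    let ψ : ↥(Subgroup.closure (T : Set Γ)) →* Γ :=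
      (((MonoidHom.snd Γ Γ).comp (RR A x).subtype).comp
        (MonoidHom.ofInjective hφ).symm.toMonoidHom).comp (Subgroup.inclusion (c1.trans hφr))
    have hψ : ∀ c : ↥(Subgroup.closure (T : Set Γ)), ((c : Γ), ψ c) ∈ RR A x := by
      intro c
      obtain ⟨q, hq⟩ : ∃ q, q = (MonoidHom.ofInjective hφ).symm (Subgroup.inclusion (c1.trans hφr) c) :=
        ⟨_, rfl⟩
      have h1 : ψ c = q.1.2 := by rw [hq]; rfl
      have h2 : (c : Γ) = q.1.1 := by
        have : MonoidHom.ofInjective hφ q = Subgroup.inclusion (c1.trans hφr) c := by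
          rw [hq]; simp
        have := congrArg Subtype.val this
        exact this.symm
      rw [h1, h2]
      exact q.2
    let f0 : FreeGroup T →* Γ := FreeGroup.lift (fun t => t.1)
    have hf0 : f0.range = Subgroup.closure (T : Set Γ) := by
      rw [FreeGroup.range_lift_eq_closure]
      simp
    let f1 : FreeGroup T →* ↥(Subgroup.closure (T : Set Γ)) :=
      f0.codRestrict _ (fun w => hf0 ▸ ⟨w, rfl⟩)
    have hf1 : Function.Surjective f1 := by
      rintro ⟨c, hc⟩
      rw [← hf0] at hc
      obtain ⟨w, hw⟩ := hc
      exact ⟨w, Subtype.ext hw⟩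
    have hxC : x ∈ Subgroup.closure (T : Set Γ) :=
      c2 (Subgroup.mem_sup_right (Subgroup.subset_closure rfl))
    have hr : (ψ.comp f1).range = ψ.range := by
      rw [MonoidHom.range_comp, MonoidHom.range_eq_top.2 hf1, ← MonoidHom.range_eq_map]
    have hfree : IsFreeGroup ψ.range := by
      apply kfree_of_lt hlt
      rw [sr_le]
      refine ⟨Finset.univ.image (fun t : T => ψ (f1 (FreeGroup.of t))), ?_, ?_⟩
      · refine Finset.card_image_le.trans ?_
        simp
        omega
      · rw [← hr]
        have h1 : ((Finset.univ.image (fun t : T => ψ (f1 (FreeGroup.of t))) : Finset Γ) : Set Γ)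
          = (ψ.comp f1) '' (Set.range FreeGroup.of) := by
          ext z; simp
        rw [h1, ← MonoidHom.map_closure, FreeGroup.closure_range_of, ← MonoidHom.range_eq_map]
    have hninj : ¬ Function.Injective (ψ.comp f1) := by
      intro hinj
      obtain ⟨w, hw⟩ := hf1 ⟨x, hxC⟩
      have h1 : ψ ⟨x, hxC⟩ = 1 := huniq x _ _ (hψ ⟨x, hxC⟩) hx1
      have h2 : w = 1 := hinj (by rw [map_one, MonoidHom.comp_apply, hw, h1])
      rw [h2, map_one] at hw
      exact hx (congrArg Subtype.val hw).symm
    obtain ⟨S, hS, hS'⟩ := fg_drop (ψ.comp f1) _ hr hninj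
    refine ⟨ψ.range, ?_, ?_, S, ?_, hS'⟩
    · rintro _ ⟨c, rfl⟩
      exact hsnd ((c : Γ), ψ c) (hψ c)
    · intro b hb
      have hbC := c2 (Subgroup.mem_sup_left hb)
      exact ⟨⟨b, hbC⟩, huniq b _ _ (hψ ⟨b, hbC⟩) (hAA b (hBA hb))⟩
    · have : Nat.card T = T.card := by simp
      omega
  obtain ⟨_, _, _, S0, hS0, _⟩ := key ⊥ bot_le Subgroup.FG.bot
  have : LocalRankLE A (s - 1) := by
    intro B h1 h2
    obtain ⟨D, d1, d2, S, hS, hS'⟩ := key B h1 h2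
    exact ⟨D, d1, d2, (sr_le _ _).2 ⟨S, by omega, hS'⟩⟩
  have := (lr_le _ _).2 this
  rw [← hs] at hle
  have := hle.trans this
  have : s ≤ s - 1 := by exact_mod_cast this
  omega

def ext' {Γ : Type*} [Group Γ] : Subgroup Γ → List Γ → Subgroup Γ
  | A, [] => A
  | A, x :: xs => ext' (A ⊔ Subgroup.closure {x}) xs

theorem ext'_append {Γ : Type*} [Group Γ] (A : Subgroup Γ) (l m : List Γ) :
    ext' A (l ++ m) = ext' (ext' A l) m := by
  induction l generalizing A with
  | nil => rfl
  | cons x l ih => exact ih _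

theorem seq_append {Γ : Type*} [Group Γ] (A : Subgroup Γ) (l m : List Γ) :
    AdmissibleSeq A (l ++ m) ↔ AdmissibleSeq A l ∧ AdmissibleSeq (ext' A l) m := by
  induction l generalizing A with
  | nil => simp [AdmissibleSeq, ext']
  | cons x l ih => simp [AdmissibleSeq, ext', ih, and_assoc]

theorem le_ext' {Γ : Type*} [Group Γ] (A : Subgroup Γ) (l : List Γ) : A ≤ ext' A l := by
  induction l generalizing A with
  | nil => exact le_rfl
  | cons x l ih => exact le_sup_left.trans (ih _)

theorem ext'_mono {Γ : Type*} [Group Γ] {A B : Subgroup Γ} (h : A ≤ B) (l : List Γ) :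
    ext' A l ≤ ext' B l := by
  induction l generalizing A B with
  | nil => exact h
  | cons x l ih => exact ih (sup_le_sup_right h _)

theorem lr_ext' {Γ : Type*} [Group Γ] {A : Subgroup Γ} {l : List Γ} (h : AdmissibleSeq A l) :
    localRank (ext' A l) ≤ localRank A := by
  induction l generalizing A with
  | nil => exact le_rfl
  | cons x l ih => exact (ih h.2).trans h.1.2

theorem seq_mono {Γ : Type*} [Group Γ] {A B : Subgroup Γ} (h : A ≤ B) (hB : StronglyClosable B)
    {l : List Γ} (hl : AdmissibleSeq A l) : AdmissibleSeq B l := by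
  induction l generalizing A B with
  | nil => trivial
  | cons x l ih =>
    have hx : Admissible B x := L2 hB (PP_mono h (L1 hl.1))
    exact ⟨hx, ih (sup_le_sup_right h _) hx.1 hl.2⟩

theorem exists_l0 {Γ : Type*} [Group Γ] {A : Subgroup Γ} (hA : Closable A) :
    ∃ l, AdmissibleSeq A l ∧ StronglyClosable (ext' A l) := by
  by_cases h : StronglyClosable A
  · exact ⟨[], trivial, h⟩
  · obtain ⟨_, z, hz⟩ := hA
    have h' : iof Γ ≤ localRank A := not_lt.1 h
    exact ⟨[z], ⟨⟨hz, (hz.trans_le h').le⟩, trivial⟩, hz⟩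

theorem mem_clo {Γ : Type*} [Group Γ] {A : Subgroup Γ} {x : Γ} :
    x ∈ clo A ↔ ∃ l, AdmissibleSeq A l ∧ StronglyClosable (ext' A l) ∧ x ∈ ext' A l := by
  constructor
  · rintro ⟨l, hl⟩
    refine ⟨l ++ [x], hl, ?_⟩
    rw [ext'_append]
    rw [seq_append] at hl
    exact ⟨hl.2.1.1, Subgroup.mem_sup_right (Subgroup.subset_closure rfl)⟩
  · rintro ⟨l, h1, h2, h3⟩
    refine ⟨l, (seq_append _ _ _).2 ⟨h1, ?_, trivial⟩⟩
    have : ext' A l ⊔ Subgroup.closure {x} = ext' A l := by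
      rw [sup_eq_left, Subgroup.closure_le]; simpa using h3
    unfold Admissible
    rw [this]
    exact ⟨h2, le_rfl⟩

theorem seq_dir {Γ : Type*} [Group Γ] {A : Subgroup Γ} {l m : List Γ} (hl : AdmissibleSeq A l)
    (hl' : StronglyClosable (ext' A l)) (hm : AdmissibleSeq A m) :
    AdmissibleSeq A (l ++ m) ∧ StronglyClosable (ext' A (l ++ m)) ∧
      localRank (ext' A (l ++ m)) ≤ localRank (ext' A l) ∧
      ext' A l ≤ ext' A (l ++ m) ∧ ext' A m ≤ ext' A (l ++ m) := by
  have h1 := seq_mono (le_ext' A l) hl' hm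
  have h2 := lr_ext' h1
  rw [ext'_append]
  exact ⟨(seq_append _ _ _).2 ⟨hl, h1⟩, lt_of_le_of_lt h2 hl', h2, le_ext' _ _,
    ext'_mono (le_ext' A l) m⟩

/-- Properties of the closure operation: (1) `clo A` is a strongly closable subgroup of `Γ`
with `localRank (clo A) ≤ localRank A`; (2) `A ≤ clo A`; (3) `clo` is monotone on closable
subgroups of `A`; (4) `clo (clo A) = clo A`. -/
theorem closure_properties {Γ : Type*} [Group Γ] (A : Subgroup Γ) (hA : Closable A) :
    (∃ H : Subgroup Γ, (H : Set Γ) = clo A ∧ StronglyClosable H ∧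
      localRank H ≤ localRank A) ∧
    (A : Set Γ) ⊆ clo A ∧
    (∀ B : Subgroup Γ, Closable B → B ≤ A → clo B ⊆ clo A) ∧
    (∀ H : Subgroup Γ, (H : Set Γ) = clo A → clo H = clo A) := by
  obtain ⟨l0, hl0, hs0⟩ := exists_l0 hA
  have hfg : ∀ H : Subgroup Γ, (H : Set Γ) = clo A → ∀ E : Subgroup Γ, E ≤ H → E.FG →
      ∃ l, AdmissibleSeq A l ∧ StronglyClosable (ext' A l) ∧ E ≤ ext' A l := by
    intro H hH E hE hEfg
    obtain ⟨K, ⟨l, h1, h2, rfl⟩, h3⟩ := fg_dir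
      (Q := fun K => ∃ l, AdmissibleSeq A l ∧ StronglyClosable (ext' A l) ∧ K = ext' A l)
      ⟨_, l0, hl0, hs0, rfl⟩ (by
        rintro _ _ ⟨l, a, b, rfl⟩ ⟨m, a', b', rfl⟩
        obtain ⟨h1, h2, h3, h4, h5⟩ := seq_dir a b a'
        exact ⟨_, ⟨_, h1, h2, rfl⟩, h4, h5⟩) hEfg (by
        intro g hg
        have : g ∈ (H : Set Γ) := hE hg
        rw [hH, mem_clo] at this
        obtain ⟨l, a, b, c⟩ := this
        exact ⟨_, ⟨l, a, b, rfl⟩, c⟩)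
    exact ⟨l, h1, h2, h3⟩
  have hsc : ∀ H : Subgroup Γ, (H : Set Γ) = clo A → localRank H ≤ localRank (ext' A l0) := by
    intro H hH
    obtain ⟨r, hr⟩ := ENat.ne_top_iff_exists.1 (ne_top_of_lt hs0)
    rw [← hr, lr_le]
    intro E hE hEfg
    obtain ⟨l, h1, h2, h3⟩ := hfg H hH E hE hEfg
    obtain ⟨a1, a2, a3, a4, a5⟩ := seq_dir hl0 hs0 h1
    rw [← hr, lr_le] at a3
    obtain ⟨C, c1, c2, c3⟩ := a3 E (h3.trans a5) hEfg
    refine ⟨C, fun c hc => ?_, c2, c3⟩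
    change c ∈ (H : Set Γ)
    rw [hH, mem_clo]
    exact ⟨_, a1, a2, c1 hc⟩
  refine ⟨?_, ?_, ?_, ?_⟩
  · let H : Subgroup Γ :=
      { carrier := clo A
        one_mem' := mem_clo.2 ⟨l0, hl0, hs0, one_mem _⟩
        mul_mem' := by
          intro a b ha hb
          obtain ⟨l, a1, a2, a3⟩ := mem_clo.1 ha
          obtain ⟨m, b1, b2, b3⟩ := mem_clo.1 hb
          obtain ⟨h1, h2, h3, h4, h5⟩ := seq_dir a1 a2 b1
          exact mem_clo.2 ⟨_, h1, h2, mul_mem (h4 a3) (h5 b3)⟩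
        inv_mem' := by
          intro a ha
          obtain ⟨l, a1, a2, a3⟩ := mem_clo.1 ha
          exact mem_clo.2 ⟨_, a1, a2, inv_mem a3⟩ }
    have := hsc H rfl
    exact ⟨H, rfl, lt_of_le_of_lt this hs0, this.trans (lr_ext' hl0)⟩
  · intro a ha
    exact mem_clo.2 ⟨l0, hl0, hs0, le_ext' _ _ ha⟩
  · rintro B - hBA x ⟨l, hl⟩
    refine ⟨l0 ++ l, ?_⟩
    rw [List.append_assoc, seq_append]
    exact ⟨hl0, seq_mono (hBA.trans (le_ext' _ _)) hs0 hl⟩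
  · intro H hH
    have hHs : StronglyClosable H := lt_of_le_of_lt (hsc H hH) hs0
    have hmem : ∀ x, Admissible H x → x ∈ H := by
      intro x hx
      obtain ⟨F, f1, f2, f3⟩ := PP_fin (L1 hx)
      obtain ⟨l, h1, h2, h3⟩ := hfg H hH F f2 f1
      have := L2 h2 (PP_mono h3 f3)
      change x ∈ (H : Set Γ)
      rw [hH]
      exact ⟨l, (seq_append _ _ _).2 ⟨h1, this, trivial⟩⟩
    have hext : ∀ l, AdmissibleSeq H l → ext' H l = H := by
      intro l
      induction l with
      | nil => intro _; rfl
      | cons x l ih =>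
        intro hl
        have : H ⊔ Subgroup.closure {x} = H := by
          rw [sup_eq_left, Subgroup.closure_le]; simpa using hmem x hl.1
        have h2 := hl.2
        rw [this] at h2
        change ext' (H ⊔ Subgroup.closure {x}) l = H
        rw [this]
        exact ih h2
    rw [← hH]
    ext x
    rw [mem_clo]
    constructor
    · rintro ⟨l, h1, _, h3⟩
      rwa [hext l h1] at h3
    · intro hx
      exact ⟨[], trivial, hHs, hx⟩
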